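/- Let (S, n) be a regular local ring of Krull dimension d ≥ 2, f ∈ n², A = S/(f), and M a maximal Cohen-Macaulay A-module without free direct summands. Then M has a 2-periodic minimal free resolution over A: there exist matrices α, β with entries in n and size n×n such that αβ = βα = f·I_n, and ... → A^n →(β) A^n →(α) A^n → M → 0 is a minimal free resolution of M. -/

import Mathlib

open CategoryTheory IsLocalRing

/-- Depth via vanishing of `Ext^i(k, M)`. -/
noncomputable def eDepth (A : Type) [CommRing A] (k M : Type)
    [AddCommGroup k] [Module A k] [AddCommGroup M] [Module A M] : ℕ∞ :=
  sInf ((fun n : ℕ => (n : ℕ∞)) ''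
    {i : ℕ | Nontrivial (((Ext A (ModuleCat A) i).obj
      (Opposite.op (ModuleCat.of A k))).obj (ModuleCat.of A M))})

/-! ### Regular local rings -/

section RegularLocal

variable {S : Type*} [CommRing S]

theorem IsLocalRing.spanFinrank_maximalIdeal_quotient_lt [IsLocalRing S] [IsNoetherianRing S]
    {x : S} [IsLocalRing (S ⧸ Ideal.span {x})]
    (hx : x ∈ maximalIdeal S) (hx2 : x ∉ maximalIdeal S ^ 2) :
    (maximalIdeal (S ⧸ Ideal.span {x})).spanFinrank + 1 ≤ (maximalIdeal S).spanFinrank := by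
  classical
  obtain ⟨s, hcard, hs⟩ := Submodule.FG.exists_span_finset_card_eq_spanFinrank
    (maximalIdeal S).fg_of_isNoetherianRing
  have hxs := hx
  rw [← hs, Submodule.mem_span_finset] at hxs
  obtain ⟨c, -, hc⟩ := hxs
  have hmem : ∀ a ∈ s, a ∈ maximalIdeal S := fun a ha => hs ▸ Submodule.subset_span ha
  obtain ⟨a, ha, hu⟩ : ∃ a ∈ s, IsUnit (c a) := by
    by_contra! h
    refine hx2 (hc ▸ Ideal.sum_mem _ fun a ha => ?_)
    rw [pow_two]
    exact Ideal.mul_mem_mul ((mem_maximalIdeal _).2 (h a ha)) (hmem a ha)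
  let p := Ideal.Quotient.mk (Ideal.span {x})
  have hp : Function.Surjective p := Ideal.Quotient.mk_surjective
  have hle : maximalIdeal (S ⧸ Ideal.span {x}) =
      Submodule.span (S ⧸ Ideal.span {x}) ((s.erase a).image p : Finset _) := by
    rw [← map_maximalIdeal_of_surjective p hp, ← hs]
    change Ideal.map p (Ideal.span (s : Set S)) = Ideal.span _
    rw [Ideal.map_span]
    apply le_antisymm
    · rw [Ideal.span_le]
      rintro _ ⟨b, hb, rfl⟩
      by_cases hba : b = a
      · subst hba
        have h0 : p (c b) * p b + ∑ a ∈ s.erase b, p (c a) * p a = 0 := by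
          have : p x = 0 := Ideal.Quotient.eq_zero_iff_mem.2 (Ideal.mem_span_singleton_self x)
          rw [← map_mul, Finset.sum_congr rfl fun a _ => (map_mul p (c a) a).symm, ← map_sum,
            ← map_add]
          rw [← Finset.add_sum_erase s _ ha] at hc
          exact (congrArg p hc).trans this
        have h1 : p (c b) * p b ∈ Ideal.span (((s.erase b).image p : Finset _) : Set _) := by
          rw [eq_neg_of_add_eq_zero_left h0]
          refine neg_mem (Ideal.sum_mem _ fun a ha => Ideal.mul_mem_left _ _ (Ideal.subset_span ?_))
          exact Finset.mem_coe.2 (Finset.mem_image_of_mem _ ha)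
        exact (Ideal.unit_mul_mem_iff_mem _ (hu.map p)).1 h1
      · exact Ideal.subset_span (Finset.mem_coe.2
          (Finset.mem_image_of_mem _ (Finset.mem_erase.2 ⟨hba, hb⟩)))
    · refine Ideal.span_mono ?_
      rw [Finset.coe_image]
      exact Set.image_mono (Finset.erase_subset _ _)
  have h1 : (maximalIdeal (S ⧸ Ideal.span {x})).spanFinrank ≤ (s.erase a).card := by
    rw [hle]
    refine (Submodule.spanFinrank_span_le_ncard_of_finite (Finset.finite_toSet _)).trans ?_
    rw [Set.ncard_coe_finset]
    exact Finset.card_image_le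
  rw [Finset.card_erase_of_mem ha] at h1
  have := Finset.card_pos.2 ⟨a, ha⟩
  omega

/-- The quotient of a regular local ring by an element of `𝔫 \ 𝔫²` is a regular local ring. -/
theorem IsRegularLocalRing.quotient_span_singleton [IsRegularLocalRing S] {x : S}
    (hx : x ∈ maximalIdeal S) (hx2 : x ∉ maximalIdeal S ^ 2) :
    IsRegularLocalRing (S ⧸ Ideal.span {x}) ∧
      ringKrullDim (S ⧸ Ideal.span {x}) + 1 = ringKrullDim S := by
  have : Nontrivial (S ⧸ Ideal.span {x}) := Ideal.Quotient.nontrivial_iff.2 fun h =>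
    (maximalIdeal.isMaximal S).ne_top (top_le_iff.1 (h ▸ (Ideal.span_singleton_le_iff_mem _).2 hx))
  have : IsLocalRing (S ⧸ Ideal.span {x}) :=
    IsLocalRing.of_surjective' (Ideal.Quotient.mk _) Ideal.Quotient.mk_surjective
  have h1 : ringKrullDim S ≤ ringKrullDim (S ⧸ Ideal.span {x}) + 1 := by
    have := ringKrullDim_le_ringKrullDim_quotient_add_card (R := S) {x}
      (by simpa [IsLocalRing.ringJacobson_eq_maximalIdeal] using hx)
    rwa [Finset.coe_singleton, Finset.card_singleton, Nat.cast_one] at this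
  have h2 := ringKrullDim_le_spanFinrank_maximalIdeal (S ⧸ Ideal.span {x})
  have h3 : (((maximalIdeal (S ⧸ Ideal.span {x})).spanFinrank + 1 : ℕ) : WithBot ℕ∞) ≤
      ringKrullDim S := by
    rw [← (isRegularLocalRing_iff S).1 ‹_›]
    exact_mod_cast spanFinrank_maximalIdeal_quotient_lt hx hx2
  push_cast at h3
  have h4 := h3.trans h1
  have hfin : ringKrullDim (S ⧸ Ideal.span {x}) + 1 ≤ ringKrullDim S :=
    (add_le_add_left h2 1).trans h3
  refine ⟨IsRegularLocalRing.of_spanFinrank_maximalIdeal_le _ ?_, le_antisymm hfin h1⟩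
  exact ENat.WithBot.add_le_add_one_right_iff.1 h4

/-- Prime avoidance in a local ring: there is an element of `𝔫 \ 𝔫²` outside finitely many
non-maximal primes. -/
theorem IsLocalRing.exists_mem_notMem_sq_notMem_primes [IsLocalRing S] [IsNoetherianRing S]
    (hS : maximalIdeal S ≠ ⊥) {T : Set (Ideal S)} (hT : T.Finite)
    (hp : ∀ p ∈ T, p.IsPrime ∧ p ≠ maximalIdeal S) :
    ∃ x ∈ maximalIdeal S, x ∉ maximalIdeal S ^ 2 ∧ ∀ p ∈ T, x ∉ p := by
  by_contra! h
  have hsub : (maximalIdeal S : Set S) ⊆ ⋃ p ∈ insert (maximalIdeal S ^ 2) T, (p : Set S) := by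
    intro x hx
    simp only [Set.mem_iUnion, Set.mem_insert_iff, exists_prop]
    by_cases hx2 : x ∈ maximalIdeal S ^ 2
    · exact ⟨_, Or.inl rfl, hx2⟩
    · obtain ⟨p, hpT, hxp⟩ := h x hx hx2
      exact ⟨p, Or.inr hpT, hxp⟩
  obtain ⟨p, hpm, hle⟩ := (Ideal.subset_union_prime_finite (f := id) (hT.insert _)
    (maximalIdeal S ^ 2) (maximalIdeal S ^ 2)
    fun i hi h1 _ => (hp i (hi.resolve_left h1)).1).1 hsub
  rcases hpm with rfl | hpT
  · refine hS (Submodule.eq_bot_of_le_smul_of_le_jacobson_bot (maximalIdeal S) _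
      (maximalIdeal S).fg_of_isNoetherianRing ?_ (maximalIdeal_le_jacobson _))
    simpa [pow_two] using hle
  · exact (hp p hpT).2 (le_antisymm (le_maximalIdeal (hp p hpT).1.ne_top) hle)

theorem IsRegularLocalRing.isDomain_of_ringKrullDim_eq (d : ℕ) :
    ∀ (S : Type*) [CommRing S] [IsRegularLocalRing S], ringKrullDim S = d → IsDomain S := by
  induction d with
  | zero =>
    intro S _ _ hd
    have h := (isRegularLocalRing_iff S).1 ‹_›
    rw [hd] at h
    have h0 : (maximalIdeal S).spanFinrank = 0 := by exact_mod_cast h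
    obtain ⟨s, hcard, hs⟩ := Submodule.FG.exists_span_finset_card_eq_spanFinrank
      (maximalIdeal S).fg_of_isNoetherianRing
    rw [h0, Finset.card_eq_zero] at hcard
    subst hcard
    have : maximalIdeal S = ⊥ := by simpa using hs.symm
    exact (isField_iff_maximalIdeal_eq.2 this).isDomain
  | succ d ih =>
    intro S _ _ hd
    have hbot : maximalIdeal S ≠ ⊥ := by
      intro h
      have := ringKrullDim_eq_zero_of_isField (isField_iff_maximalIdeal_eq.2 h)
      rw [hd] at this
      exact absurd this (by exact_mod_cast Nat.succ_ne_zero d)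
    have hT : ∀ p ∈ minimalPrimes S, p.IsPrime ∧ p ≠ maximalIdeal S := by
      refine fun p hp => ⟨Ideal.IsMinimalPrime.isPrime hp, ?_⟩
      rintro rfl
      have h1 := (maximalIdeal_height_eq_ringKrullDim (R := S)).symm
      rw [hd, Ideal.height_eq_zero_iff.2 hp] at h1
      exact absurd h1 (by exact_mod_cast Nat.succ_ne_zero d)
    obtain ⟨x, hx, hx2, hxp⟩ := IsLocalRing.exists_mem_notMem_sq_notMem_primes hbot
      (minimalPrimes.finite_of_isNoetherianRing S) hT
    obtain ⟨h1, h2⟩ := IsRegularLocalRing.quotient_span_singleton hx hx2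
    have hdim : ringKrullDim (S ⧸ Ideal.span {x}) = d := by
      rw [hd] at h2
      push_cast at h2
      exact ENat.WithBot.add_one_cancel.1 h2
    have := ih _ hdim
    have hprime : (Ideal.span {x}).IsPrime := (Ideal.Quotient.isDomain_iff_prime _).1 this
    obtain ⟨p, hp, hpx⟩ := Ideal.exists_minimalPrimes_le (bot_le : ⊥ ≤ Ideal.span {x})
    have hpp : p.IsPrime := hp.1.1
    have hp0 : p = ⊥ := by
      refine Submodule.eq_bot_of_le_smul_of_le_jacobson_bot (maximalIdeal S) p
        p.fg_of_isNoetherianRing ?_ (maximalIdeal_le_jacobson _)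
      intro a ha
      obtain ⟨b, rfl⟩ := Ideal.mem_span_singleton.1 (hpx ha)
      exact Submodule.smul_mem_smul hx ((hpp.mem_or_mem ha).resolve_left (hxp p hp))
    subst hp0
    exact IsDomain.of_bot_isPrime S

end RegularLocal

/-! ### Vanishing of `Ext` through a relatively projective complex -/

/-- A complex of `R`-modules augmented to `R ⧸ I` whose terms have the lifting property against
surjections of `R`-modules killed by `f`. A projective resolution of `R ⧸ I` over `R ⧸ (f)`
gives such a complex. -/
structure RelProjComplex (R : Type) [CommRing R] (f : R) (I : Ideal R) where
  X : ℕ → Type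
  [addCommGroup : ∀ i, AddCommGroup (X i)]
  [module : ∀ i, Module R (X i)]
  d : ∀ i, X (i + 1) →ₗ[R] X i
  d_comp_d : ∀ i, d i ∘ₗ d (i + 1) = 0
  aug : X 0 →ₗ[R] R ⧸ I
  aug_surjective : Function.Surjective aug
  aug_comp_d : aug ∘ₗ d 0 = 0
  lift : ∀ i {M N : Type} [AddCommGroup M] [AddCommGroup N] [Module R M] [Module R N]
    (p : M →ₗ[R] N), Function.Surjective p → (∀ m : M, f • m = 0) →
    ∀ φ : X i →ₗ[R] N, ∃ ψ : X i →ₗ[R] M, p ∘ₗ ψ = φ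

namespace RelProjComplex

attribute [instance] RelProjComplex.addCommGroup RelProjComplex.module

variable {R : Type} [CommRing R] {f : R} {I : Ideal R} (P : RelProjComplex R f I)

/-- Exactness of `Hom(P, M)` in degree `i`. -/
def HomExact (M : Type) [AddCommGroup M] [Module R M] : ℕ → Prop
  | 0 => ∀ φ : P.X 0 →ₗ[R] M, φ ∘ₗ P.d 0 = 0 → φ = 0
  | i + 1 => ∀ φ : P.X (i + 1) →ₗ[R] M, φ ∘ₗ P.d (i + 1) = 0 →
      ∃ ψ : P.X i →ₗ[R] M, φ = ψ ∘ₗ P.d i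

variable {P} {M N : Type} [AddCommGroup M] [AddCommGroup N] [Module R M] [Module R N]

theorem HomExact.eq_zero (h : P.HomExact M 0) {m : M} (hm : ∀ r ∈ I, r • m = 0) : m = 0 := by
  let g : R ⧸ I →ₗ[R] M := I.liftQ (LinearMap.toSpanSingleton R M m) fun r hr => by
    simpa using hm r hr
  have hg : g ∘ₗ P.aug = 0 := h _ (by rw [LinearMap.comp_assoc, P.aug_comp_d, LinearMap.comp_zero])
  obtain ⟨y, hy⟩ := P.aug_surjective (Submodule.Quotient.mk 1)
  have := LinearMap.congr_fun hg y
  have h1 : g (Submodule.Quotient.mk 1) = m := by simp only [g, Submodule.liftQ_apply]; simp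
  rw [← h1, ← hy]
  exact this

theorem HomExact.of_exact (hM : ∀ m : M, f • m = 0) {θ : M →ₗ[R] M} (hθ : Function.Injective θ)
    {p : M →ₗ[R] N} (hp : Function.Surjective p) (hex : Function.Exact θ p) {i : ℕ}
    (h₀ : P.HomExact M i) (h : P.HomExact M (i + 1)) : P.HomExact N i := by
  have key : ∀ φ : P.X i →ₗ[R] N, φ ∘ₗ P.d i = 0 →
      ∃ χ : P.X i →ₗ[R] M, χ ∘ₗ P.d i = 0 ∧ p ∘ₗ χ = φ := by
    intro φ hφ
    obtain ⟨φ', rfl⟩ := P.lift i p hp hM φ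
    have hmem : ∀ y, (φ' ∘ₗ P.d i) y ∈ LinearMap.range θ := fun y =>
      (hex _).1 (LinearMap.congr_fun hφ y)
    let e := LinearEquiv.ofInjective θ hθ
    let τ : P.X (i + 1) →ₗ[R] M := e.symm.toLinearMap ∘ₗ (φ' ∘ₗ P.d i).codRestrict _ hmem
    have hτ : θ ∘ₗ τ = φ' ∘ₗ P.d i := by
      ext y
      simp [e, τ]
    have hτ0 : τ ∘ₗ P.d (i + 1) = 0 := by
      ext y
      apply hθ
      have := LinearMap.congr_fun hτ (P.d (i + 1) y)
      have h0 := LinearMap.congr_fun (P.d_comp_d i) y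
      simp only [LinearMap.comp_apply, LinearMap.zero_apply] at this h0 ⊢
      rw [this, h0, map_zero, map_zero]
    obtain ⟨ψ, hψ⟩ := h τ hτ0
    refine ⟨φ' - θ ∘ₗ ψ, ?_, ?_⟩
    · rw [LinearMap.sub_comp, LinearMap.comp_assoc, ← hψ, hτ, sub_self]
    · ext y
      simp [hex.apply_apply_eq_zero]
  cases i with
  | zero =>
    intro φ hφ
    obtain ⟨χ, hχ, rfl⟩ := key φ hφ
    rw [h₀ χ hχ, LinearMap.comp_zero]
  | succ i =>
    intro φ hφ
    obtain ⟨χ, hχ, rfl⟩ := key φ hφ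
    obtain ⟨ψ, rfl⟩ := h₀ χ hχ
    exact ⟨p ∘ₗ ψ, (LinearMap.comp_assoc _ _ _).symm⟩

end RelProjComplex

section

open scoped Pointwise

variable {S : Type*} [CommRing S] {x : S} {K F M : Type*} [AddCommGroup K] [AddCommGroup F]
  [AddCommGroup M] [Module S K] [Module S F] [Module S M] {ι : K →ₗ[S] F} {π : F →ₗ[S] M}

theorem QuotSMulTop.exists_exact_of_isSMulRegular (hι : Function.Injective ι)
    (hex : Function.Exact ι π) (hπ : Function.Surjective π) (hx : IsSMulRegular M x) :
    ∃ (ι' : QuotSMulTop x K →ₗ[S ⧸ Ideal.span {x}] QuotSMulTop x F)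
      (π' : QuotSMulTop x F →ₗ[S ⧸ Ideal.span {x}] QuotSMulTop x M),
      Function.Injective ι' ∧ Function.Exact ι' π' ∧ Function.Surjective π' := by
  have hsurj : Function.Surjective (algebraMap S (S ⧸ Ideal.span {x})) :=
    Ideal.Quotient.mk_surjective
  refine ⟨LinearMap.extendScalarsOfSurjective hsurj (QuotSMulTop.map x ι),
    LinearMap.extendScalarsOfSurjective hsurj (QuotSMulTop.map x π), ?_,
    QuotSMulTop.map_exact x hex hπ, QuotSMulTop.map_surjective x hπ⟩
  rw [← LinearMap.ker_eq_bot, LinearMap.ker_eq_bot']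
  intro k hk
  obtain ⟨k, rfl⟩ := Submodule.Quotient.mk_surjective _ k
  have hk' : ι k ∈ x • (⊤ : Submodule S F) := (Submodule.Quotient.mk_eq_zero _).1 hk
  obtain ⟨y, -, hy⟩ := (Submodule.mem_smul_pointwise_iff_exists _ _ _).1 hk'
  have hy0 : π y = 0 := by
    refine hx.right_eq_zero_of_smul ?_
    rw [← map_smul, hy, hex.apply_apply_eq_zero]
  obtain ⟨z, rfl⟩ := (hex y).1 hy0
  rw [← map_smul] at hy
  rw [Submodule.Quotient.mk_eq_zero, ← hι hy]
  exact Submodule.smul_mem_pointwise_smul _ _ _ trivial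

theorem QuotSMulTop.exact_lsmul_mkQ (x : S) (M : Type*) [AddCommGroup M] [Module S M] :
    Function.Exact (LinearMap.lsmul S M x) (x • (⊤ : Submodule S M)).mkQ := by
  intro m
  rw [Submodule.mkQ_apply, Submodule.Quotient.mk_eq_zero, Submodule.mem_smul_pointwise_iff_exists]
  simp

/-- In a local ring, a finite module without elements killed by `𝔫` admits a regular element
in `𝔫 \ 𝔫²`. -/
theorem IsLocalRing.exists_isSMulRegular_notMem_sq [IsLocalRing S] [IsNoetherianRing S]
    (hS : maximalIdeal S ≠ ⊥) [Module.Finite S M]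
    (hM : ∀ m : M, (∀ r ∈ maximalIdeal S, r • m = 0) → m = 0) :
    ∃ x ∈ maximalIdeal S, x ∉ maximalIdeal S ^ 2 ∧ IsSMulRegular M x := by
  have hT : ∀ p ∈ associatedPrimes S M, p.IsPrime ∧ p ≠ maximalIdeal S := by
    refine fun p hp => ⟨IsAssociatedPrime.isPrime hp, ?_⟩
    rintro rfl
    obtain ⟨hp, m, hm⟩ := (isAssociatedPrime_iff_exists_injective_linearMap _ _).1 hp
    have h1 : m (Submodule.Quotient.mk 1) = 0 := hM _ fun r hr => by
      rw [← map_smul, ← Submodule.Quotient.mk_smul, (Submodule.Quotient.mk_eq_zero _).2, map_zero]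
      simpa using hr
    have h2 := hm (h1.trans (map_zero m).symm)
    rw [Submodule.Quotient.mk_eq_zero] at h2
    exact (Ideal.ne_top_iff_one _).1 hp.ne_top h2
  obtain ⟨x, hx, hx2, hxp⟩ := IsLocalRing.exists_mem_notMem_sq_notMem_primes hS
    (associatedPrimes.finite S M) hT
  refine ⟨x, hx, hx2, isSMulRegular_iff_right_eq_zero_of_smul.2 fun m hm => ?_⟩
  by_contra hm0
  have : x ∈ ⋃ p ∈ associatedPrimes S M, (p : Set S) := by
    rw [biUnion_associatedPrimes_eq_zero_divisors]
    exact ⟨m, hm0, hm⟩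
  obtain ⟨p, hp, hxp'⟩ := Set.mem_iUnion₂.1 this
  exact hxp p hp hxp'

end

open scoped Pointwise in
theorem RelProjComplex.HomExact.quotSMulTop {R : Type} [CommRing R] {f : R} {I : Ideal R}
    {P : RelProjComplex R f I} {S : Type} [CommRing S] [Algebra R S] {M : Type} [AddCommGroup M]
    [Module R M] [Module S M] [IsScalarTower R S M] (hM : ∀ m : M, f • m = 0) {x : S}
    (hx : IsSMulRegular M x) {i : ℕ} (h₀ : P.HomExact M i) (h : P.HomExact M (i + 1)) :
    P.HomExact (QuotSMulTop x M) i := by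
  let θ : M →ₗ[R] M := (LinearMap.lsmul S M x).restrictScalars R
  let p : M →ₗ[R] QuotSMulTop x M := (x • (⊤ : Submodule S M)).mkQ.restrictScalars R
  have hex : Function.Exact θ p := fun m => QuotSMulTop.exact_lsmul_mkQ x M m
  have hp : Function.Surjective p := Submodule.mkQ_surjective (x • (⊤ : Submodule S M))
  exact h₀.of_exact hM (θ := θ) hx hp hex h

theorem RelProjComplex.free_of_exact {R : Type} [CommRing R] [IsLocalRing R] {f : R}
    (P : RelProjComplex R f (maximalIdeal R)) (n : ℕ) :
    ∀ (S : Type) [CommRing S] [IsRegularLocalRing S] [Algebra R S]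
      (_ : Function.Surjective (algebraMap R S)) (_ : ringKrullDim S = (n + 1 : ℕ))
      (M : Type) [AddCommGroup M] [Module R M] [Module S M] [IsScalarTower R S M]
      (_ : ∀ m : M, f • m = 0) (_ : ∀ i < n, P.HomExact M i)
      (F K : Type) [AddCommGroup F] [Module S F] [Module.Free S F] [Module.Finite S F]
      [AddCommGroup K] [Module S K] (ι : K →ₗ[S] F) (π : F →ₗ[S] M)
      (_ : Function.Injective ι) (_ : Function.Exact ι π) (_ : Function.Surjective π),
      Module.Free S K := by
  induction n with
  | zero =>
    intro S _ _ _ _ hdim M _ _ _ _ _ _ F K _ _ _ _ _ _ ι π hι _ _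
    have : IsDomain S := IsRegularLocalRing.isDomain_of_ringKrullDim_eq _ S hdim
    have hreg := (isRegularLocalRing_iff S).1 ‹_›
    rw [hdim] at hreg
    have h1 : (maximalIdeal S).spanFinrank = 1 := by exact_mod_cast hreg
    obtain ⟨s, hcard, hs⟩ := Submodule.FG.exists_span_finset_card_eq_spanFinrank
      (maximalIdeal S).fg_of_isNoetherianRing
    rw [h1, Finset.card_eq_one] at hcard
    obtain ⟨x, rfl⟩ := hcard
    have hpr : (maximalIdeal S).IsPrincipal := ⟨⟨x, by rw [← hs, Finset.coe_singleton]⟩⟩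
    have : IsPrincipalIdealRing S :=
      ((tfae_of_isNoetherianRing_of_isLocalRing_of_isDomain S).out 0 4).2 hpr
    have : Module.Finite S K := Module.Finite.of_injective ι hι
    have : Module.IsTorsionFree S K := hι.moduleIsTorsionFree _ (map_smul ι)
    exact Module.free_of_finite_type_torsion_free'
  | succ n ih =>
    intro S _ _ _ hRS hdim M _ _ _ _ hM hdepth F K _ _ _ _ _ _ ι π hι hex hπ
    have : IsDomain S := IsRegularLocalRing.isDomain_of_ringKrullDim_eq _ S hdim
    have : Module.Finite S M := Module.Finite.of_surjective π hπ
    have : Module.Finite S K := Module.Finite.of_injective ι hι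
    have : IsLocalHom (algebraMap R S) := hRS.isLocalHom _
    have hbot : maximalIdeal S ≠ ⊥ := by
      intro h
      have := ringKrullDim_eq_zero_of_isField (isField_iff_maximalIdeal_eq.2 h)
      rw [hdim] at this
      exact Nat.succ_ne_zero (n + 1) (by exact_mod_cast this)
    obtain ⟨x, hx, hx2, hxM⟩ := IsLocalRing.exists_isSMulRegular_notMem_sq (M := M) hbot
      fun m hm => (hdepth 0 (Nat.succ_pos _)).eq_zero fun r hr => by
        rw [← algebraMap_smul S]
        exact hm _ ((mem_maximalIdeal _).2 (map_nonunit (algebraMap R S) r hr))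
    obtain ⟨hreg', h2⟩ := IsRegularLocalRing.quotient_span_singleton hx hx2
    have hdim' : ringKrullDim (S ⧸ Ideal.span {x}) = (n + 1 : ℕ) := by
      rw [hdim] at h2
      push_cast at h2
      exact_mod_cast ENat.WithBot.add_one_cancel.1 h2
    have hx0 : x ≠ 0 := fun h => hx2 (h ▸ zero_mem _)
    have hxK : IsSMulRegular K x := by
      have : Module.IsTorsionFree S K := hι.moduleIsTorsionFree _ (map_smul ι)
      exact IsSMulRegular.of_ne_zero hx0
    have : IsScalarTower R (S ⧸ Ideal.span {x}) (QuotSMulTop x M) := by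
      refine ⟨fun r s m => ?_⟩
      rw [← algebraMap_smul S r s, smul_assoc, algebraMap_smul]
    have : Module.Finite (S ⧸ Ideal.span {x}) (QuotSMulTop x F) :=
      Module.Finite.of_restrictScalars_finite S _ _
    have hxF : IsSMulRegular F x := IsSMulRegular.of_ne_zero hx0
    have : Module.FinitePresentation S F := Module.finitePresentation_of_finite S F
    have : Module.Free (S ⧸ Ideal.span {x}) (QuotSMulTop x F) :=
      (Module.free_quotSMulTop_iff_free S F (maximalIdeal_le_jacobson _ hx) hxF).2 inferInstance
    have hRS' : Function.Surjective (algebraMap R (S ⧸ Ideal.span {x})) := by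
      rw [IsScalarTower.algebraMap_eq R S (S ⧸ Ideal.span {x}), RingHom.coe_comp]
      exact Ideal.Quotient.mk_surjective.comp hRS
    have hdepth' : ∀ i < n, P.HomExact (QuotSMulTop x M) i := fun i hi =>
      (hdepth i (by omega)).quotSMulTop hM hxM (hdepth (i + 1) (by omega))
    obtain ⟨ι', π', hι', hex', hπ'⟩ := QuotSMulTop.exists_exact_of_isSMulRegular hι hex hπ hxM
    have hfree : Module.Free (S ⧸ Ideal.span {x}) (QuotSMulTop x K) := by
      refine ih (S ⧸ Ideal.span {x}) hRS' hdim'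
        (QuotSMulTop x M) (fun m => ?_) hdepth' (QuotSMulTop x F) (QuotSMulTop x K) ι' π'
        hι' hex' hπ'
      obtain ⟨m, rfl⟩ := Submodule.Quotient.mk_surjective _ m
      rw [← Submodule.Quotient.mk_smul, hM, Submodule.Quotient.mk_zero]
    have : Module.FinitePresentation S K := Module.finitePresentation_of_finite S K
    exact (Module.free_quotSMulTop_iff_free S K (maximalIdeal_le_jacobson _ hx) hxK).1 hfree

section

variable {S A : Type} [CommRing S] [CommRing A] [Algebra S A]

theorem Module.exists_isScalarTower_of_surjective (hsurj : Function.Surjective (algebraMap S A))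
    (M : Type) [AddCommGroup M] [Module S M]
    (hM : ∀ r ∈ RingHom.ker (algebraMap S A), ∀ m : M, r • m = 0) :
    ∃ _ : Module A M, IsScalarTower S A M := by
  let e := RingHom.quotientKerEquivOfSurjective hsurj
  have ht : Module.IsTorsionBySet S M (RingHom.ker (algebraMap S A) : Set S) :=
    fun m r => hM r r.2 m
  let := ht.module
  let : Module A M := Module.compHom M (e.symm : A →+* S ⧸ RingHom.ker (algebraMap S A))
  refine ⟨inferInstance, IsScalarTower.of_algebraMap_smul fun r m => ?_⟩
  change e.symm (algebraMap S A r) • m = r • m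
  have : e.symm (algebraMap S A r) = Ideal.Quotient.mk _ r := by
    rw [RingEquiv.symm_apply_eq]
    rfl
  rw [this]
  exact ht.mk_smul r m

theorem Ideal.nonempty_linearEquiv_quotient_map (hsurj : Function.Surjective (algebraMap S A))
    {I : Ideal S} (hI : RingHom.ker (algebraMap S A) ≤ I) :
    Nonempty ((A ⧸ I.map (algebraMap S A)) ≃ₗ[S] S ⧸ I) := by
  let g : S →ₗ[S] A ⧸ I.map (algebraMap S A) := Algebra.linearMap S _
  have hg : Function.Surjective g := by
    have : Function.Surjective (algebraMap S (A ⧸ I.map (algebraMap S A))) := by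
      rw [IsScalarTower.algebraMap_eq S A (A ⧸ _), RingHom.coe_comp]
      exact Ideal.Quotient.mk_surjective.comp hsurj
    exact this
  have hker : LinearMap.ker g = I := by
    ext r
    change algebraMap S (A ⧸ I.map (algebraMap S A)) r = 0 ↔ _
    rw [IsScalarTower.algebraMap_apply S A (A ⧸ _), Ideal.Quotient.algebraMap_eq,
      Ideal.Quotient.eq_zero_iff_mem, ← Ideal.mem_comap,
      Ideal.comap_map_of_surjective' _ hsurj, sup_eq_left.2 hI]
  exact ⟨((Submodule.quotEquivOfEq _ _ hker.symm).trans
    (g.quotKerEquivOfSurjective hg)).symm⟩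

/-- A projective complex over `A = S ⧸ (f)` as a relatively projective complex over `S`. -/
noncomputable def RelProjComplex.ofProjective (hsurj : Function.Surjective (algebraMap S A))
    {f : S} (hker : RingHom.ker (algebraMap S A) = Ideal.span {f}) {I : Ideal S} (hf : f ∈ I)
    (X : ℕ → Type) [∀ i, AddCommGroup (X i)] [∀ i, Module A (X i)] [∀ i, Module S (X i)]
    [∀ i, IsScalarTower S A (X i)] [∀ i, Module.Projective A (X i)]
    (d : ∀ i, X (i + 1) →ₗ[A] X i) (hd : ∀ i, d i ∘ₗ d (i + 1) = 0)
    (aug : X 0 →ₗ[A] A ⧸ I.map (algebraMap S A)) (haug : Function.Surjective aug)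
    (haugd : aug ∘ₗ d 0 = 0) : RelProjComplex S f I where
  X := X
  d i := (d i).restrictScalars S
  d_comp_d i := by
    ext x
    exact LinearMap.congr_fun (hd i) x
  aug := (Ideal.nonempty_linearEquiv_quotient_map hsurj (I := I)
    (hker ▸ (Ideal.span_singleton_le_iff_mem I).2 hf)).some.toLinearMap ∘ₗ aug.restrictScalars S
  aug_surjective := (LinearEquiv.surjective _).comp haug
  aug_comp_d := by
    ext x
    have := LinearMap.congr_fun haugd x
    simp only [LinearMap.comp_apply, LinearMap.zero_apply, LinearMap.restrictScalars_apply] at this ⊢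
    rw [this, map_zero]
  lift i M N _ _ _ _ p hp hM φ := by
    have hann : ∀ r ∈ RingHom.ker (algebraMap S A), ∀ m : M, r • m = 0 := by
      intro r hr m
      rw [hker, Ideal.mem_span_singleton'] at hr
      obtain ⟨a, rfl⟩ := hr
      rw [mul_smul, hM, smul_zero]
    obtain ⟨_, _⟩ := Module.exists_isScalarTower_of_surjective hsurj M hann
    obtain ⟨_, _⟩ := Module.exists_isScalarTower_of_surjective hsurj N fun r hr n => by
      obtain ⟨m, rfl⟩ := hp n
      rw [← map_smul, hann r hr, map_zero]
    obtain ⟨ψ, hψ⟩ := Module.projective_lifting_property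
      (LinearMap.extendScalarsOfSurjective hsurj p) (LinearMap.extendScalarsOfSurjective hsurj φ) hp
    refine ⟨ψ.restrictScalars S, ?_⟩
    ext x
    exact LinearMap.congr_fun hψ x

/-- If `Extⁱ(A ⧸ IA, M) = 0` for `i < n`, then `Hom(P, M)` is exact in degrees `< n` for some
relatively projective complex `P`. -/
theorem RelProjComplex.exists_homExact (hsurj : Function.Surjective (algebraMap S A))
    {f : S} (hker : RingHom.ker (algebraMap S A) = Ideal.span {f}) {I : Ideal S} (hf : f ∈ I)
    (M : Type) [AddCommGroup M] [Module A M] [Module S M] [IsScalarTower S A M] (n : ℕ)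
    (hExt : ∀ i < n, Subsingleton (((Ext A (ModuleCat A) i).obj
      (Opposite.op (ModuleCat.of A (A ⧸ I.map (algebraMap S A))))).obj (ModuleCat.of A M))) :
    ∃ P : RelProjComplex S f I, ∀ i < n, P.HomExact M i := by
  let Q := projectiveResolution (ModuleCat.of A (A ⧸ I.map (algebraMap S A)))
  let : ∀ i, Module S (Q.complex.X i) := fun i => Module.compHom _ (algebraMap S A)
  have : ∀ i, IsScalarTower S A (Q.complex.X i) := fun i =>
    IsScalarTower.of_algebraMap_smul fun r m => rfl
  have : ∀ i, Module.Projective A (Q.complex.X i) := fun i => by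
    exact (IsProjective.iff_projective (Q.complex.X i)).2 (Q.projective i)
  let P : RelProjComplex S f I := RelProjComplex.ofProjective hsurj hker hf
    (fun i => Q.complex.X i) (fun i => (Q.complex.d (i + 1) i).hom)
    (fun i => by rw [← ModuleCat.hom_comp, Q.complex.d_comp_d]; rfl)
    (Q.π.f 0).hom ((ModuleCat.epi_iff_surjective _).1 inferInstance)
    (congrArg ModuleCat.Hom.hom Q.complex_d_comp_π_f_zero)
  have hex : ∀ i < n, (Q.complex.linearYonedaObj A (ModuleCat.of A M)).ExactAt i := by
    intro i hi
    rw [HomologicalComplex.exactAt_iff_isZero_homology]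
    have := hExt i hi
    exact (ModuleCat.isZero_of_subsingleton _).of_iso (Q.isoExt i _).symm
  have hA : ∀ i (φ : Q.complex.X i →ₗ[S] M), φ ∘ₗ P.d i = 0 →
      Q.complex.d (i + 1) i ≫ ModuleCat.ofHom (LinearMap.extendScalarsOfSurjective hsurj φ) = 0 :=
    fun i φ hφ => by
      ext x
      exact LinearMap.congr_fun hφ x
  refine ⟨P, fun i hi => ?_⟩
  have := hex i hi
  cases i with
  | zero =>
    intro (φ : Q.complex.X 0 →ₗ[S] M) hφ
    rw [HomologicalComplex.exactAt_iff' _ 0 0 1 (by simp) (by simp),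
      ShortComplex.moduleCat_exact_iff] at this
    obtain ⟨g, hg⟩ := this _ (hA 0 φ hφ)
    have hd : (Q.complex.linearYonedaObj A (ModuleCat.of A M)).d 0 0 = 0 :=
      HomologicalComplex.shape _ _ _ (by simp)
    have hg' : ModuleCat.ofHom (LinearMap.extendScalarsOfSurjective hsurj φ) = 0 := by
      rw [← hg]
      change (Q.complex.linearYonedaObj A (ModuleCat.of A M)).d 0 0 g = 0
      rw [hd]
      rfl
    ext x
    exact LinearMap.congr_fun (congrArg ModuleCat.Hom.hom hg') x
  | succ i =>
    intro (φ : Q.complex.X (i + 1) →ₗ[S] M) hφ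
    rw [HomologicalComplex.exactAt_iff' _ i (i + 1) (i + 1 + 1) (by simp) (by simp),
      ShortComplex.moduleCat_exact_iff] at this
    obtain ⟨g, hg⟩ := this _ (hA (i + 1) φ hφ)
    have hg' : Q.complex.d (i + 1) i ≫ g =
      ModuleCat.ofHom (LinearMap.extendScalarsOfSurjective hsurj φ) := hg
    refine ⟨(ModuleCat.Hom.hom g).restrictScalars S, ?_⟩
    ext x
    exact (LinearMap.congr_fun (congrArg ModuleCat.Hom.hom hg') x).symm

end

open TensorProduct in
/-- A finite module over a local ring has a minimal system of generators. -/
theorem IsLocalRing.exists_minimal_generators (S M : Type*) [CommRing S] [IsLocalRing S]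
    [AddCommGroup M] [Module S M] [Module.Finite S M] :
    ∃ (N : ℕ) (m : Fin N → M), Submodule.span S (Set.range m) = ⊤ ∧
      ∀ v : Fin N → S, ∑ i, v i • m i = 0 → ∀ i, v i ∈ maximalIdeal S := by
  let b := Module.finBasis (ResidueField S) (ResidueField S ⊗[S] M)
  choose m hm using fun i => TensorProduct.mk_surjective S M (ResidueField S)
    IsLocalRing.residue_surjective (b i)
  refine ⟨_, m, IsLocalRing.span_eq_top_of_tmul_eq_basis m b hm, fun v hv i => ?_⟩
  have h := congrArg (TensorProduct.mk S (ResidueField S) M 1) hv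
  simp only [map_sum, map_smul, map_zero, hm] at h
  have h' : ∑ i, residue S (v i) • b i = 0 := by
    rw [← h]
    exact Finset.sum_congr rfl fun i _ => algebraMap_smul (ResidueField S) (v i) (b i)
  exact (residue_eq_zero_iff _).1 (Fintype.linearIndependent_iff.1 b.linearIndependent _ h' i)

section

variable {S A : Type*} [CommRing S] [CommRing A] {q : S →+* A} {f : S} {N : ℕ}

theorem RingHom.exists_eq_smul_of_comp_eq_zero (hker : RingHom.ker q = Ideal.span {f})
    {w : Fin N → S} (hw : ∀ i, q (w i) = 0) : ∃ u : Fin N → S, w = f • u := by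
  have h : ∀ i, ∃ a, a * f = w i := fun i =>
    Ideal.mem_span_singleton'.1 (hker ▸ (hw i : w i ∈ RingHom.ker q))
  choose u hu using h
  exact ⟨u, funext fun i => by rw [← hu, Pi.smul_apply, smul_eq_mul, mul_comm]⟩

theorem Matrix.map_mul_map_eq_zero (hf : q f = 0) {α β : Matrix (Fin N) (Fin N) S}
    (h : α * β = f • (1 : Matrix (Fin N) (Fin N) S)) : α.map q * β.map q = 0 := by
  rw [← Matrix.map_mul, h]
  ext i j
  simp [hf]

/-- A matrix factorization of `f` over `S` gives an exact pair over `S ⧸ (f)`. -/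
theorem Matrix.ker_mulVecLin_map_eq_range [IsDomain S] (hq : Function.Surjective q) (hf0 : f ≠ 0)
    (hker : RingHom.ker q = Ideal.span {f}) {α β : Matrix (Fin N) (Fin N) S}
    (hαβ : α * β = f • (1 : Matrix (Fin N) (Fin N) S))
    (hβα : β * α = f • (1 : Matrix (Fin N) (Fin N) S)) :
    LinearMap.ker (α.map q).mulVecLin = LinearMap.range (β.map q).mulVecLin := by
  have hqf : q f = 0 := by
    rw [← RingHom.mem_ker, hker]
    exact Ideal.mem_span_singleton_self f
  apply le_antisymm
  · intro v hv
    obtain ⟨w, rfl⟩ := hq.comp_left v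
    obtain ⟨u, hu⟩ := RingHom.exists_eq_smul_of_comp_eq_zero hker (w := α.mulVec w) fun i => by
      rw [RingHom.map_mulVec]
      exact congrFun hv i
    have h : f • w = f • β.mulVec u := by
      rw [← Matrix.mulVec_smul, ← hu, Matrix.mulVec_mulVec, hβα, Matrix.smul_mulVec,
        Matrix.one_mulVec]
    refine ⟨q ∘ u, ?_⟩
    rw [smul_right_injective _ hf0 h]
    ext i
    exact (RingHom.map_mulVec q β u i).symm
  · rintro _ ⟨u, rfl⟩
    rw [LinearMap.mem_ker, Matrix.mulVecLin_apply, Matrix.mulVecLin_apply, Matrix.mulVec_mulVec,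
      Matrix.map_mul_map_eq_zero hqf hαβ, Matrix.zero_mulVec]

end

/-- A free module of relations on a minimal system of generators gives a matrix factorization. -/
theorem Matrix.exists_factorization_of_free_ker {S M : Type*} [CommRing S] [IsDomain S]
    [IsNoetherianRing S] [AddCommGroup M] [Module S M] {N : ℕ} (π : (Fin N → S) →ₗ[S] M) {f : S}
    (hf0 : f ≠ 0) (hM : ∀ m : M, f • m = 0) [Module.Free S (LinearMap.ker π)] :
    ∃ α β : Matrix (Fin N) (Fin N) S, LinearMap.ker π = LinearMap.range α.mulVecLin ∧
      α * β = f • (1 : Matrix (Fin N) (Fin N) S) ∧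
      β * α = f • (1 : Matrix (Fin N) (Fin N) S) := by
  let K := LinearMap.ker π
  let γ : (Fin N → S) →ₗ[S] K := (f • LinearMap.id).codRestrict K fun v => by
    rw [LinearMap.mem_ker, LinearMap.smul_apply, map_smul, hM]
  have hγ : Function.Injective γ := fun v w h =>
    smul_right_injective _ hf0 (congrArg Subtype.val h)
  have hrank : Module.finrank S K = N := by
    refine le_antisymm ?_ ?_
    · simpa using LinearMap.finrank_le_finrank_of_injective K.subtype_injective
    · simpa using LinearMap.finrank_le_finrank_of_injective hγ
  let e := (Module.finBasisOfFinrankEq S K hrank).equivFun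
  let a : (Fin N → S) →ₗ[S] (Fin N → S) := K.subtype ∘ₗ e.symm.toLinearMap
  let b : (Fin N → S) →ₗ[S] (Fin N → S) := e.toLinearMap ∘ₗ γ
  have hab : a ∘ₗ b = f • LinearMap.id := by
    refine LinearMap.ext fun v => ?_
    simp [a, b, γ]
  have hba : b ∘ₗ a = f • LinearMap.id := by
    refine LinearMap.ext fun v => ?_
    have ha : Function.Injective a := K.subtype_injective.comp e.symm.injective
    apply ha
    have := LinearMap.congr_fun hab (a v)
    simp only [LinearMap.comp_apply, LinearMap.smul_apply, LinearMap.id_apply, map_smul] at this ⊢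
    exact this
  refine ⟨LinearMap.toMatrix' a, LinearMap.toMatrix' b, ?_, ?_, ?_⟩
  · rw [← Matrix.toLin'_apply', Matrix.toLin'_toMatrix']
    rw [LinearMap.range_comp, LinearEquiv.range, Submodule.map_top, Submodule.range_subtype]
  · rw [← LinearMap.toMatrix'_comp, hab, map_smul, LinearMap.toMatrix'_id]
  · rw [← LinearMap.toMatrix'_comp, hba, map_smul, LinearMap.toMatrix'_id]

theorem Ext.subsingleton_of_lt_eDepth {A k M : Type} [CommRing A] [AddCommGroup k] [Module A k]
    [AddCommGroup M] [Module A M] {i : ℕ} (h : (i : ℕ∞) < eDepth A k M) :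
    Subsingleton (((Ext A (ModuleCat A) i).obj
      (Opposite.op (ModuleCat.of A k))).obj (ModuleCat.of A M)) := by
  rw [← not_nontrivial_iff_subsingleton]
  exact fun hi => (sInf_le ⟨i, hi, rfl⟩ : eDepth A k M ≤ i).not_gt h

theorem IsRegularLocalRing.of_exists_finset {S : Type*} [CommRing S] [IsLocalRing S]
    [IsNoetherianRing S] (hreg : ∃ s : Finset S, Ideal.span (s : Set S) = maximalIdeal S ∧
      (s.card : WithBot ℕ∞) = ringKrullDim S) : IsRegularLocalRing S := by
  obtain ⟨s, hs, hcard⟩ := hreg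
  apply IsRegularLocalRing.of_spanFinrank_maximalIdeal_le
  rw [← hcard, ← hs, ← Set.ncard_coe_finset]
  exact_mod_cast Submodule.spanFinrank_span_le_ncard_of_finite s.finite_toSet

/-- Eisenbud's theorem on matrix factorizations: let `(S, 𝔫)` be a regular local ring
of Krull dimension `d ≥ 2`, `0 ≠ f ∈ 𝔫²`, `A = S/(f)`, and let `M` be a maximal
Cohen-Macaulay `A`-module (i.e. `depth_A M = d − 1`) without free direct summands.
Then `M` has a 2-periodic minimal free resolution over `A`: there are `N × N`
matrices `α, β` with entries in `𝔫` such that `αβ = βα = f·I` and the complex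
`⋯ → Aᴺ →(β̄) Aᴺ →(ᾱ) Aᴺ → M → 0` is exact, with minimality witnessed by the
entries of `α` and `β` lying in the maximal ideal. -/
theorem stmt5 (S : Type) [CommRing S] [IsLocalRing S] [IsNoetherianRing S]
    (hreg : ∃ s : Finset S, Ideal.span (s : Set S) = maximalIdeal S ∧
      (s.card : WithBot ℕ∞) = ringKrullDim S)
    (d : ℕ) (hd : 2 ≤ d) (hdim : ringKrullDim S = d)
    (f : S) (hf0 : f ≠ 0) (hf : f ∈ (maximalIdeal S) ^ 2)
    (A : Type) [CommRing A] (q : S →+* A) (hq : Function.Surjective q)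
    (hker : RingHom.ker q = Ideal.span {f})
    (M : Type) [AddCommGroup M] [Module A M] [Module.Finite A M]
    (hMCM : eDepth A (A ⧸ Ideal.map q (maximalIdeal S)) M = (d - 1 : ℕ))
    (hnofree : ¬ ∃ φ : M →ₗ[A] A, Function.Surjective φ) :
    ∃ (N : ℕ) (α β : Matrix (Fin N) (Fin N) S),
      (∀ i j, α i j ∈ maximalIdeal S) ∧ (∀ i j, β i j ∈ maximalIdeal S) ∧
      α * β = f • (1 : Matrix (Fin N) (Fin N) S) ∧
      β * α = f • (1 : Matrix (Fin N) (Fin N) S) ∧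
      ∃ π : (Fin N → A) →ₗ[A] M,
        Function.Surjective π ∧
        LinearMap.ker π = LinearMap.range (Matrix.mulVecLin (α.map q)) ∧
        LinearMap.ker (Matrix.mulVecLin (α.map q)) =
          LinearMap.range (Matrix.mulVecLin (β.map q)) ∧
        LinearMap.ker (Matrix.mulVecLin (β.map q)) =
          LinearMap.range (Matrix.mulVecLin (α.map q)) := by
  obtain ⟨n, rfl⟩ : ∃ n, d = n + 1 := ⟨d - 1, by omega⟩
  have : IsRegularLocalRing S := IsRegularLocalRing.of_exists_finset hreg
  have : IsDomain S := IsRegularLocalRing.isDomain_of_ringKrullDim_eq _ S hdim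
  let _ : Algebra S A := q.toAlgebra
  let _ : Module S M := Module.compHom M q
  have : IsScalarTower S A M := IsScalarTower.of_algebraMap_smul fun _ _ => rfl
  have hfq : q f = 0 := by
    rw [← RingHom.mem_ker, hker]
    exact Ideal.mem_span_singleton_self f
  have hM : ∀ m : M, f • m = 0 := fun m => by
    change q f • m = 0
    rw [hfq, zero_smul]
  have : Module.Finite S A := Module.Finite.of_surjective (Algebra.linearMap S A) hq
  have : Module.Finite S M := Module.Finite.trans A M
  obtain ⟨P, hP⟩ := RelProjComplex.exists_homExact (S := S) (A := A) hq hker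
    (Ideal.pow_le_self two_ne_zero hf) M n fun i hi => Ext.subsingleton_of_lt_eDepth
      (hMCM ▸ by exact_mod_cast hi)
  obtain ⟨N, m, hspan, hmin⟩ := IsLocalRing.exists_minimal_generators S M
  let π₀ : (Fin N → S) →ₗ[S] M := Fintype.linearCombination S m
  have hπ₀ : Function.Surjective π₀ := by
    rw [← LinearMap.range_eq_top, Fintype.range_linearCombination, hspan]
  have : Module.Free S (LinearMap.ker π₀) :=
    P.free_of_exact n S Function.surjective_id hdim M hM hP (Fin N → S) (LinearMap.ker π₀)
      (LinearMap.ker π₀).subtype π₀ (Submodule.subtype_injective _)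
      (LinearMap.exact_subtype_ker_map π₀) hπ₀
  obtain ⟨α, β, hα, hαβ, hβα⟩ := Matrix.exists_factorization_of_free_ker π₀ hf0 hM
  let π : (Fin N → A) →ₗ[A] M := Fintype.linearCombination A m
  have hππ₀ : ∀ v : Fin N → S, π (q ∘ v) = π₀ v := fun v => rfl
  have hπ : Function.Surjective π := fun y => by
    obtain ⟨v, rfl⟩ := hπ₀ y
    exact ⟨q ∘ v, rfl⟩
  have hkerπ : LinearMap.ker π = LinearMap.range (α.map q).mulVecLin := by
    apply le_antisymm
    · intro v hv
      obtain ⟨w, rfl⟩ := hq.comp_left v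
      obtain ⟨u, rfl⟩ := hα.le (show w ∈ LinearMap.ker π₀ from hv)
      exact ⟨q ∘ u, funext fun i => (RingHom.map_mulVec q α u i).symm⟩
    · rintro _ ⟨u, rfl⟩
      obtain ⟨u, rfl⟩ := hq.comp_left u
      have h : (α.map q).mulVecLin (q ∘ u) = q ∘ α.mulVec u :=
        funext fun i => (RingHom.map_mulVec q α u i).symm
      rw [LinearMap.mem_ker, h, hππ₀]
      exact hα.ge ⟨u, rfl⟩
  refine ⟨N, α, β, fun i j => ?_, fun i j => ?_, hαβ, hβα, π, hπ, hkerπ,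
    Matrix.ker_mulVecLin_map_eq_range hq hf0 hker hαβ hβα,
    Matrix.ker_mulVecLin_map_eq_range hq hf0 hker hβα hαβ⟩
  · have h : π₀ (α.mulVec (Pi.single j 1)) = 0 := hα.ge ⟨_, rfl⟩
    have := hmin _ h i
    rwa [Matrix.mulVec_single_one, Matrix.col_apply] at this
  · by_contra hβ
    let g : (Fin N → A) →ₗ[A] A := LinearMap.proj i ∘ₗ (β.map q).mulVecLin
    have hg : LinearMap.ker π ≤ LinearMap.ker g := by
      rw [hkerπ]
      rintro _ ⟨u, rfl⟩
      rw [LinearMap.mem_ker, LinearMap.comp_apply, Matrix.mulVecLin_apply, Matrix.mulVecLin_apply,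
        Matrix.mulVec_mulVec, Matrix.map_mul_map_eq_zero hfq hβα, Matrix.zero_mulVec]
      rfl
    have hgj : g (Pi.single j 1) = q (β i j) := by simp [g]
    have hunit : IsUnit (q (β i j)) := by
      rw [mem_maximalIdeal, mem_nonunits_iff, not_not] at hβ
      exact hβ.map q
    let φ : M →ₗ[A] A := (LinearMap.ker π).liftQ g hg ∘ₗ
      (π.quotKerEquivOfSurjective hπ).symm.toLinearMap
    have hφ : ∀ v, φ (π v) = g v := fun v => by
      simp only [φ, LinearMap.comp_apply, LinearEquiv.coe_coe]
      rw [← LinearMap.quotKerEquivOfSurjective_apply_mk π hπ, LinearEquiv.symm_apply_apply,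
        Submodule.liftQ_apply]
    obtain ⟨u, hu⟩ := hunit.exists_left_inv
    refine hnofree ⟨φ, fun y => ⟨(y * u) • π (Pi.single j 1), ?_⟩⟩
    rw [map_smul, hφ, hgj, smul_eq_mul, mul_assoc, hu, mul_one]
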